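/- arXiv:1710.10933 — 2 statements merged into one kernel-verified Lean document; each statement's English description precedes it below -/
import Mathlib

section
/- Let ψ : ℝ^d → ℝ be bounded and let φ : ℝ^d → ℝ satisfy |φ(x)| ≤ M for all x and be M-Lipschitz with respect to δ. Then sup_{x ∈ ℝ^d} |R[ψ](x) − φ(x)| ≤ sup_{x ∈ ℝ^d} |ψ(x) − φ(x)|. -/
open scoped BigOperators

/-- `δ(p) := M ∑_i |p_i|`. -/
noncomputable def delta (d : ℕ) (M : ℝ) (p : Fin d → ℝ) : ℝ := M * ∑ i, |p i|

/-- The face-lift `F[ψ](x) := sup_{p ∈ ℝ^d} (ψ(x+p) − δ(p))`. -/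
noncomputable def faceLift (d : ℕ) (M : ℝ) (ψ : (Fin d → ℝ) → ℝ) (x : Fin d → ℝ) : ℝ :=
  ⨆ p : Fin d → ℝ, (ψ (x + p) - delta d M p)

/-- The truncated face-lift `R[ψ](x) := max(−M, min(F[ψ](x), M))`. -/
noncomputable def truncFaceLift (d : ℕ) (M : ℝ) (ψ : (Fin d → ℝ) → ℝ) (x : Fin d → ℝ) : ℝ :=
  max (-M) (min (faceLift d M ψ x) M)

theorem delta_zero (d : ℕ) (M : ℝ) : delta d M 0 = 0 := by
  simp [delta]

theorem delta_nonneg (d : ℕ) {M : ℝ} (hM : 0 ≤ M) (p : Fin d → ℝ) : 0 ≤ delta d M p :=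
  mul_nonneg hM (Finset.sum_nonneg fun _ _ => abs_nonneg _)

/-- The face-lift of a function bounded above dominates the function. -/
theorem le_faceLift (d : ℕ) {M : ℝ} (hM : 0 ≤ M) {ψ : (Fin d → ℝ) → ℝ} {C : ℝ}
    (hψ : ∀ x, ψ x ≤ C) (x : Fin d → ℝ) : ψ x ≤ faceLift d M ψ x := by
  have hbdd : BddAbove (Set.range fun p : Fin d → ℝ => ψ (x + p) - delta d M p) := by
    refine ⟨C, ?_⟩
    rintro _ ⟨p, rfl⟩
    exact (sub_le_self _ (delta_nonneg d hM p)).trans (hψ _)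
  simpa [faceLift, delta_zero] using le_ciSup hbdd 0

/-- If `ψ ≤ φ + S` with `φ` Lipschitz with respect to `δ`, then the face-lift of `ψ` is at most
`φ + S`. -/
theorem faceLift_le_add (d : ℕ) {M : ℝ} {ψ φ : (Fin d → ℝ) → ℝ} {S : ℝ}
    (hφ : ∀ x y : Fin d → ℝ, |φ x - φ y| ≤ M * ∑ i, |x i - y i|)
    (h : ∀ x, ψ x ≤ φ x + S) (x : Fin d → ℝ) : faceLift d M ψ x ≤ φ x + S := by
  refine ciSup_le fun p => ?_
  have hp : φ (x + p) - φ x ≤ delta d M p := by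
    simpa [delta] using (le_abs_self _).trans (hφ (x + p) x)
  linarith [h (x + p)]

/-- Let `ψ : ℝ^d → ℝ` be bounded and let `φ : ℝ^d → ℝ` satisfy
`|φ(x)| ≤ M` for all `x` and be `M`-Lipschitz with respect to `δ`. Then
`sup_x |R[ψ](x) − φ(x)| ≤ sup_x |ψ(x) − φ(x)|`. -/
theorem truncFaceLift_nonexpansive_at_fixed_point (d : ℕ) (hd : 1 ≤ d) (M : ℝ) (hM : 0 < M)
    (ψ : (Fin d → ℝ) → ℝ) (hψ : ∃ C : ℝ, ∀ x, |ψ x| ≤ C)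
    (φ : (Fin d → ℝ) → ℝ) (hφbdd : ∀ x, |φ x| ≤ M)
    (hφLip : ∀ x y : Fin d → ℝ, |φ x - φ y| ≤ M * ∑ i, |x i - y i|) :
    (⨆ x : Fin d → ℝ, |truncFaceLift d M ψ x - φ x|) ≤ ⨆ x : Fin d → ℝ, |ψ x - φ x| := by
  obtain ⟨C, hC⟩ := hψ
  have hbdd : BddAbove (Set.range fun x : Fin d → ℝ => |ψ x - φ x|) := by
    refine ⟨C + M, ?_⟩
    rintro _ ⟨x, rfl⟩
    exact (abs_sub _ _).trans (add_le_add (hC x) (hφbdd x))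
  refine ciSup_le fun x => ?_
  set S := ⨆ x : Fin d → ℝ, |ψ x - φ x|
  have hS : ∀ y, |ψ y - φ y| ≤ S := fun y => le_ciSup hbdd y
  have hS_nonneg : 0 ≤ S := (abs_nonneg _).trans (hS x)
  have hupper : faceLift d M ψ x ≤ φ x + S :=
    faceLift_le_add d hφLip (fun y => by linarith [(abs_le.mp (hS y)).2]) x
  have hlower : ψ x ≤ faceLift d M ψ x :=
    le_faceLift d hM.le (fun y => (le_abs_self _).trans (hC y)) x
  obtain ⟨hφ_lower, hφ_upper⟩ := abs_le.mp (hφbdd x)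
  have hψ_lower := (abs_le.mp (hS x)).1
  rw [truncFaceLift, abs_le]
  constructor
  · have hmin : φ x - S ≤ min (faceLift d M ψ x) M := le_min (by linarith) (by linarith)
    linarith [le_max_right (-M) (min (faceLift d M ψ x) M)]
  · have hmax : max (-M) (min (faceLift d M ψ x) M) ≤ φ x + S :=
      max_le (by linarith) ((min_le_left _ _).trans hupper)
    linarith
end

section
/- Let L₀ ≥ 1 and q₀ ≥ 0 be integers, L := {0, 1, …, L₀}^{q₀+1}, and n := |L| = (L₀+1)^{q₀+1} (so n ≥ 2). Let Ĉ₁ ≥ 1 and Ĉ₂ > 0 be real constants, and let h be a real number with 0 < h < min(1, Ĉ₁^{−(n−1)} / ((n+1)(n−1) Ĉ₂)). Then: (i) Ĉ₁^{1−n} − h (n+1)(n−1) Ĉ₂ > 0, so that K := (Ĉ₁^{1−n} − h (n+1)(n−1) Ĉ₂)^{1/(1−n)} is a well-defined positive real number; (ii) the ordinary differential equation η′(t) = Ĉ₂ ∑_{ℓ ∈ L} η(t)^{‖ℓ‖₁}, where ‖ℓ‖₁ := ℓ₀ + ℓ₁ + ⋯ + ℓ_{q₀}, with initial condition η(0) =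 Ĉ₁, has a unique (differentiable) solution η on the interval [0, h]; and (iii) this solution satisfies η(t) ≤ K for all t ∈ [0, h]. -/
open scoped BigOperators

open Set in
/-- A bounded, globally Lipschitz autonomous vector field has a solution on `[0, h]`. -/
lemma exists_hasDerivWithinAt_Icc_of_lipschitz_of_bounded {f : ℝ → ℝ} {K M : NNReal}
    (hf : LipschitzWith K f) (hM : ∀ x, ‖f x‖ ≤ M) (C : ℝ) {h : ℝ} (hh : 0 ≤ h) :
    ∃ α : ℝ → ℝ, α 0 = C ∧
      ∀ t ∈ Icc (0 : ℝ) h, HasDerivWithinAt α (f (α t)) (Icc (0 : ℝ) h) t := by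
  lift h to NNReal using hh
  have hPL : IsPicardLindelof (fun _ ↦ f) (⟨0, left_mem_Icc.2 h.2⟩ : Icc (0 : ℝ) h)
      C (M * h) 0 M K :=
    .of_time_independent (fun x _ ↦ hM x) hf.lipschitzOnWith (by simp)
  exact hPL.exists_eq_forall_mem_Icc_hasDerivWithinAt₀

open Set Metric in
/-- Two solutions on `[0, h]` of a `C¹` autonomous equation with the same initial value agree. -/
lemma eqOn_Icc_of_hasDerivWithinAt_of_contDiff {f : ℝ → ℝ} (hf : ContDiff ℝ 1 f)
    {α β : ℝ → ℝ} {h : ℝ}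
    (hα : ∀ t ∈ Icc (0 : ℝ) h, HasDerivWithinAt α (f (α t)) (Icc (0 : ℝ) h) t)
    (hβ : ∀ t ∈ Icc (0 : ℝ) h, HasDerivWithinAt β (f (β t)) (Icc (0 : ℝ) h) t)
    (h0 : α 0 = β 0) : EqOn α β (Icc (0 : ℝ) h) := by
  have hαc : ContinuousOn α (Icc 0 h) := fun t ht ↦ (hα t ht).continuousWithinAt
  have hβc : ContinuousOn β (Icc 0 h) := fun t ht ↦ (hβ t ht).continuousWithinAt
  obtain ⟨R, hR⟩ := ((isCompact_Icc.image_of_continuousOn hαc).union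
    (isCompact_Icc.image_of_continuousOn hβc)).isBounded.subset_closedBall 0
  obtain ⟨K, hK⟩ := hf.contDiffOn.exists_lipschitzOnWith one_ne_zero (convex_closedBall 0 R)
    (isCompact_closedBall 0 R)
  have hIci {γ : ℝ → ℝ}
      (hγ : ∀ t ∈ Icc (0 : ℝ) h, HasDerivWithinAt γ (f (γ t)) (Icc (0 : ℝ) h) t) :
      ∀ t ∈ Ico (0 : ℝ) h, HasDerivWithinAt γ (f (γ t)) (Ici t) t := fun t ht ↦
    (hγ t (Ico_subset_Icc_self ht)).mono_of_mem_nhdsWithin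
      (Filter.mem_of_superset (Icc_mem_nhdsGE ht.2) (Icc_subset_Icc_left ht.1))
  exact ODE_solution_unique_of_mem_Icc_right (v := fun _ ↦ f) (s := fun _ ↦ closedBall 0 R)
    (fun _ _ ↦ hK) hαc (hIci hα)
    (fun t ht ↦ hR (.inl (mem_image_of_mem α (Ico_subset_Icc_self ht))))
    hβc (hIci hβ) (fun t ht ↦ hR (.inr (mem_image_of_mem β (Ico_subset_Icc_self ht)))) h0

open Set in
/-- Comparison with the explicit solution of `y' = D * y ^ p`: a function whose derivative `v`
satisfies `0 ≤ v` and, where it is at least its initial value `C`, `v ≤ D * α ^ p`, stays below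
that solution. -/
lemma mem_Icc_of_hasDerivWithinAt_le_rpow {α v : ℝ → ℝ} {C D p h : ℝ} (hC : 0 < C)
    (hp : 1 < p) (hD : 0 ≤ D) (h0 : α 0 = C)
    (hα : ∀ t ∈ Icc (0 : ℝ) h, HasDerivWithinAt α (v t) (Icc (0 : ℝ) h) t)
    (hv0 : ∀ t ∈ Icc (0 : ℝ) h, 0 ≤ v t)
    (hv : ∀ t ∈ Icc (0 : ℝ) h, C ≤ α t → v t ≤ D * α t ^ p)
    (hpos : 0 < C ^ (1 - p) - h * ((p - 1) * D)) :
    ∀ t ∈ Icc (0 : ℝ) h,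
      α t ∈ Icc C ((C ^ (1 - p) - h * ((p - 1) * D)) ^ (1 / (1 - p))) := by
  intro t ht
  have h0mem : (0 : ℝ) ∈ Icc 0 h := left_mem_Icc.2 (ht.1.trans ht.2)
  have hαc : ContinuousOn α (Icc 0 h) := fun t ht ↦ (hα t ht).continuousWithinAt
  have hint {t : ℝ} (ht : t ∈ interior (Icc (0 : ℝ) h)) : t ∈ Icc (0 : ℝ) h := interior_subset ht
  have hmono : MonotoneOn α (Icc 0 h) :=
    monotoneOn_of_hasDerivWithinAt_nonneg (convex_Icc 0 h) hαc
      (fun t ht ↦ (hα t (hint ht)).mono interior_subset) (fun t ht ↦ hv0 t (hint ht))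
  have hge : ∀ t ∈ Icc (0 : ℝ) h, C ≤ α t := fun t ht ↦ h0 ▸ hmono h0mem ht ht.1
  have hαpos : ∀ t ∈ Icc (0 : ℝ) h, 0 < α t := fun t ht ↦ hC.trans_le (hge t ht)
  have hderiv : ∀ t ∈ Icc (0 : ℝ) h,
      HasDerivWithinAt (fun s ↦ α s ^ (1 - p) + s * ((p - 1) * D))
        (v t * (1 - p) * α t ^ (1 - p - 1) + 1 * ((p - 1) * D)) (Icc 0 h) t := fun t ht ↦
    ((hα t ht).rpow_const (.inl (hαpos t ht).ne')).add ((hasDerivWithinAt_id t _).mul_const _)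
  have hmono' : MonotoneOn (fun s ↦ α s ^ (1 - p) + s * ((p - 1) * D)) (Icc 0 h) := by
    refine monotoneOn_of_hasDerivWithinAt_nonneg (convex_Icc 0 h)
      (fun t ht ↦ (hderiv t ht).continuousWithinAt)
      (fun t ht ↦ (hderiv t (hint ht)).mono interior_subset) fun t ht ↦ ?_
    have ht := hint ht
    have hle : v t * α t ^ (-p) ≤ D := by
      rw [Real.rpow_neg (hαpos t ht).le, ← div_eq_mul_inv,
        div_le_iff₀ (Real.rpow_pos_of_pos (hαpos t ht) p)]
      exact hv t ht (hge t ht)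
    rw [show 1 - p - 1 = -p by ring]
    nlinarith
  have hlow : C ^ (1 - p) - h * ((p - 1) * D) ≤ α t ^ (1 - p) := by
    have h1 := hmono' h0mem ht ht.1
    simp only [h0, zero_mul, add_zero] at h1
    have h2 : t * ((p - 1) * D) ≤ h * ((p - 1) * D) :=
      mul_le_mul_of_nonneg_right ht.2 (mul_nonneg (by linarith) hD)
    linarith
  refine ⟨hge t ht, ?_⟩
  have hpow := Real.rpow_le_rpow_of_nonpos hpos hlow
    (one_div_nonpos.2 (by linarith : 1 - p ≤ 0))
  rwa [← Real.rpow_mul (hαpos t ht).le, mul_one_div_cancel (by linarith), Real.rpow_one] at hpow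

open Set in
/-- If a `C¹` vector field satisfies `0 ≤ f x ≤ D * x ^ p` for `x ≥ C`, then the equation
`y' = f y`, `y 0 = C` has a solution on `[0, h]` as long as the solution of `y' = D * y ^ p` with
the same initial value has not exploded by time `h`, and the solution is bounded by the latter. -/
lemma exists_hasDerivWithinAt_Icc_le_of_le_rpow {f : ℝ → ℝ} (hf : ContDiff ℝ 1 f)
    {C D p h : ℝ} (hC : 0 < C) (hh : 0 ≤ h) (hp : 1 < p) (hD : 0 ≤ D)
    (hf0 : ∀ x, C ≤ x → 0 ≤ f x) (hfD : ∀ x, C ≤ x → f x ≤ D * x ^ p)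
    (hpos : 0 < C ^ (1 - p) - h * ((p - 1) * D)) :
    ∃ η : ℝ → ℝ, η 0 = C ∧
      (∀ t ∈ Icc (0 : ℝ) h, HasDerivWithinAt η (f (η t)) (Icc (0 : ℝ) h) t) ∧
      ∀ t ∈ Icc (0 : ℝ) h, η t ≤ (C ^ (1 - p) - h * ((p - 1) * D)) ^ (1 / (1 - p)) := by
  set B := (C ^ (1 - p) - h * ((p - 1) * D)) ^ (1 / (1 - p))
  obtain ⟨K, hK⟩ := hf.contDiffOn.exists_lipschitzOnWith one_ne_zero (convex_Icc C (max C B))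
    isCompact_Icc
  obtain ⟨M, hM⟩ := isCompact_Icc.exists_bound_of_continuousOn
    (s := Icc C (max C B)) hf.continuous.continuousOn
  let c : ℝ → ℝ := fun x ↦ max C (min x B)
  have hc : ∀ x, c x ∈ Icc C (max C B) := fun x ↦
    ⟨le_max_left _ _, max_le_max le_rfl (min_le_right _ _)⟩
  have hcL : LipschitzWith 1 c := (LipschitzWith.id.min_const B).const_max C
  have hfc : LipschitzWith (K * 1) (f ∘ c) :=
    lipschitzOnWith_univ.1 (hK.comp hcL.lipschitzOnWith fun x _ ↦ hc x)
  obtain ⟨η, hη0, hη⟩ := exists_hasDerivWithinAt_Icc_of_lipschitz_of_bounded (M := M.toNNReal) hfc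
    (fun x ↦ (hM _ (hc x)).trans (Real.le_coe_toNNReal M)) C hh
  have hmem := mem_Icc_of_hasDerivWithinAt_le_rpow hC hp hD hη0 hη
    (fun t _ ↦ hf0 _ (hc (η t)).1)
    (fun t _ hCt ↦ (hfD _ (hc (η t)).1).trans <| by
      have : c (η t) ≤ η t := max_le hCt (min_le_left _ _)
      have : 0 ≤ c (η t) := hC.le.trans (hc (η t)).1
      gcongr) hpos
  refine ⟨η, hη0, fun t ht ↦ ?_, fun t ht ↦ (hmem t ht).2⟩
  have hct : c (η t) = η t := by
    have hle : η t ≤ B := (hmem t ht).2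
    simp only [c, min_eq_left hle, max_eq_right (hmem t ht).1]
  simpa only [Function.comp_apply, hct] using hη t ht

/-- For `x ≥ 1`, a sum of `x ^ ‖ℓ‖₁` over `ℓ ∈ {0, …, L}^(q+1)` is at most `n * x ^ n`, where `n`
is the number of terms. -/
lemma sum_pow_sum_le_card_mul_pow (L q : ℕ) {x : ℝ} (hx : 1 ≤ x) :
    ∑ ℓ : Fin (q + 1) → Fin (L + 1), x ^ (∑ i, (ℓ i : ℕ)) ≤
      ((L + 1) ^ (q + 1) : ℕ) * x ^ ((L + 1) ^ (q + 1)) := by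
  have hdeg (ℓ : Fin (q + 1) → Fin (L + 1)) : ∑ i, (ℓ i : ℕ) ≤ (L + 1) ^ (q + 1) := by
    have h1 : ∑ i, (ℓ i : ℕ) ≤ (q + 1) * L := by
      simpa using Finset.sum_le_card_nsmul Finset.univ (fun i ↦ (ℓ i : ℕ)) L
        fun i _ ↦ Fin.is_le (ℓ i)
    have h2 : (1 : ℤ) + ((q + 1 : ℕ) : ℤ) * L ≤ (1 + L) ^ (q + 1) :=
      one_add_mul_le_pow (by omega) _
    have h3 : 1 + (q + 1) * L ≤ (1 + L) ^ (q + 1) := by exact_mod_cast h2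
    rw [add_comm 1 L] at h3
    omega
  refine (Finset.sum_le_card_nsmul _ _ _ fun ℓ _ ↦ pow_le_pow_right₀ hx (hdeg ℓ)).trans_eq ?_
  simp

/-- Let `L₀ ≥ 1`, `q₀ ≥ 0` be integers, `L := {0,…,L₀}^{q₀+1}` and
`n := |L| = (L₀+1)^{q₀+1}` (so `n ≥ 2`). Let `Ĉ₁ ≥ 1`, `Ĉ₂ > 0` and
`0 < h < min(1, Ĉ₁^{−(n−1)} / ((n+1)(n−1) Ĉ₂))`. Then:
(i) `Ĉ₁^{1−n} − h (n+1)(n−1) Ĉ₂ > 0`, so that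
`K := (Ĉ₁^{1−n} − h (n+1)(n−1) Ĉ₂)^{1/(1−n)}` is a well-defined positive real;
(ii) the ODE `η′(t) = Ĉ₂ ∑_{ℓ ∈ L} η(t)^{‖ℓ‖₁}` with `η(0) = Ĉ₁` has a unique solution
on `[0, h]`; and (iii) this solution satisfies `η(t) ≤ K` on `[0, h]`. -/
theorem ode_explosion_bound (L₀ q₀ : ℕ) (hL₀ : 1 ≤ L₀)
    (n : ℕ) (hn : n = (L₀ + 1) ^ (q₀ + 1))
    (C₁ C₂ h : ℝ) (hC₁ : 1 ≤ C₁) (hC₂ : 0 < C₂) (hh0 : 0 < h)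
    (hh : h < min 1 (C₁ ^ (-((n : ℝ) - 1)) / (((n : ℝ) + 1) * ((n : ℝ) - 1) * C₂))) :
    (0 < C₁ ^ ((1 : ℝ) - n) - h * ((n : ℝ) + 1) * ((n : ℝ) - 1) * C₂) ∧
    (0 < (C₁ ^ ((1 : ℝ) - n) - h * ((n : ℝ) + 1) * ((n : ℝ) - 1) * C₂)
        ^ ((1 : ℝ) / ((1 : ℝ) - n))) ∧
    ∃ η : ℝ → ℝ,
      (η 0 = C₁ ∧
        ∀ t ∈ Set.Icc (0 : ℝ) h,
          HasDerivWithinAt η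
            (C₂ * ∑ ℓ : Fin (q₀ + 1) → Fin (L₀ + 1), η t ^ (∑ q, (ℓ q : ℕ)))
            (Set.Icc (0 : ℝ) h) t) ∧
      (∀ η' : ℝ → ℝ,
        (η' 0 = C₁ ∧
          ∀ t ∈ Set.Icc (0 : ℝ) h,
            HasDerivWithinAt η'
              (C₂ * ∑ ℓ : Fin (q₀ + 1) → Fin (L₀ + 1), η' t ^ (∑ q, (ℓ q : ℕ)))
              (Set.Icc (0 : ℝ) h) t) →
        Set.EqOn η' η (Set.Icc (0 : ℝ) h)) ∧
      (∀ t ∈ Set.Icc (0 : ℝ) h,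
        η t ≤ (C₁ ^ ((1 : ℝ) - n) - h * ((n : ℝ) + 1) * ((n : ℝ) - 1) * C₂)
          ^ ((1 : ℝ) / ((1 : ℝ) - n))) := by
  have hn2 : (2 : ℝ) ≤ n := by
    have : 2 ≤ n := hn ▸ (by omega : 2 ≤ L₀ + 1).trans (Nat.le_self_pow (by omega) _)
    exact_mod_cast this
  have hpos : 0 < C₁ ^ ((1 : ℝ) - n) - h * ((n : ℝ) + 1) * ((n : ℝ) - 1) * C₂ := by
    have hlt := hh.trans_le (min_le_right _ _)
    have hden : 0 < ((n : ℝ) + 1) * ((n : ℝ) - 1) * C₂ :=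
      mul_pos (mul_pos (by linarith) (by linarith)) hC₂
    rw [lt_div_iff₀ hden, neg_sub] at hlt
    linarith
  refine ⟨hpos, Real.rpow_pos_of_pos hpos _, ?_⟩
  have hC₁0 : 0 < C₁ := by linarith
  have hf : ContDiff ℝ 1 fun x : ℝ ↦
      C₂ * ∑ ℓ : Fin (q₀ + 1) → Fin (L₀ + 1), x ^ (∑ q, (ℓ q : ℕ)) := by
    fun_prop
  have heq : h * ((n : ℝ) + 1) * ((n : ℝ) - 1) * C₂ = h * (((n : ℝ) - 1) * ((n + 1) * C₂)) := by
    ring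
  rw [heq] at hpos ⊢
  obtain ⟨η, hη0, hη, hηle⟩ := exists_hasDerivWithinAt_Icc_le_of_le_rpow hf hC₁0 hh0.le
    (by linarith : (1 : ℝ) < n) (by positivity : 0 ≤ ((n : ℝ) + 1) * C₂)
    (fun x hx ↦ by
      have : 0 ≤ x := hC₁0.le.trans hx
      positivity)
    (fun x hx ↦ by
      have hx1 : 1 ≤ x := hC₁.trans hx
      have hsum := sum_pow_sum_le_card_mul_pow L₀ q₀ hx1
      rw [← hn] at hsum
      have hxn : 0 ≤ x ^ n := by positivity
      rw [Real.rpow_natCast]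
      calc _ ≤ C₂ * (n * x ^ n) := by gcongr
        _ ≤ C₂ * ((n + 1) * x ^ n) := by gcongr; linarith
        _ = _ := by ring) hpos
  exact ⟨η, ⟨hη0, hη⟩, fun η' hη' ↦
    eqOn_Icc_of_hasDerivWithinAt_of_contDiff hf hη'.2 hη (hη'.1.trans hη0.symm), hηle⟩
end
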